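/- Let d ≥ 1, 1/2 ≤ s < 1 and L₀ ≥ 2. There is a constant C = C(d,s) such that for every R ≥ 1 and every function u : ℝ^d → ℝ with |u| ≤ 1 on ℝ^d which is Lipschitz on B_{2R} with ‖∇u‖_{L^∞(B_{2R})} ≤ L₀, one has J^s(u, B_R) ≤ C · ( R^{d−2s} + L₀^{2s−1} · log(2 L₀ R) · ∫_{B_{2R}} |∇u(x)| dx ). -/

import Mathlib

open MeasureTheory Metric Set
open scoped ENNReal NNReal

/-- The fractional `s`-energy `J^s(u,Ω)` of `u : ℝ^d → ℝ` on an open set `Ω`: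
`J^s(u,Ω) = ∬_{(ℝ^d×ℝ^d)∖(Ωᶜ×Ωᶜ)} |u(x)−u(y)|²/|x−y|^{d+2s} dy dx`, valued in `[0,∞]`. -/
noncomputable def Js (d : ℕ) (s : ℝ) (u : EuclideanSpace ℝ (Fin d) → ℝ)
    (Ω : Set (EuclideanSpace ℝ (Fin d))) : ℝ≥0∞ :=
  ∫⁻ p : EuclideanSpace ℝ (Fin d) × EuclideanSpace ℝ (Fin d) in (Ωᶜ ×ˢ Ωᶜ)ᶜ,
    ENNReal.ofReal ((u p.1 - u p.2)^2 / ‖p.1 - p.2‖ ^ ((d : ℝ) + 2*s))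

lemma aux_seg {E : Type*} [NormedAddCommGroup E] [NormedSpace ℝ E] [FiniteDimensional ℝ E]
    [MeasurableSpace E] [BorelSpace E] (μ : Measure E) [μ.IsAddHaarMeasure]
    (v : E → ℝ) (K : ℝ≥0) (hv : LipschitzWith K v) (z : E) :
    ∀ᵐ x ∂μ, ‖v (x + z) - v x‖ₑ ≤ ∫⁻ t in Ioc (0:ℝ) 1, ‖fderiv ℝ v (x + t • z)‖ₑ * ‖z‖ₑ := by
  have h1 : ∀ᵐ t : ℝ, ∀ᵐ x ∂μ, DifferentiableAt ℝ v (x + t • z) := by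
    refine Filter.Eventually.of_forall fun t => ?_
    exact (measurePreserving_add_right μ (t • z)).quasiMeasurePreserving.ae
      (hv.ae_differentiableAt (μ := μ))
  have hm : MeasurableSet {p : ℝ × E | DifferentiableAt ℝ v (p.2 + p.1 • z)} :=
    (measurableSet_of_differentiableAt ℝ v).preimage
      (by fun_prop : Measurable fun p : ℝ × E => p.2 + p.1 • z)
  rw [Measure.ae_ae_comm hm] at h1
  filter_upwards [h1] with x hx
  have hl : LipschitzWith (K * ‖z‖₊) (fun t : ℝ => v (x + t • z)) := by
    refine hv.comp ?_
    refine LipschitzWith.of_dist_le_mul fun a b => ?_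
    simp [dist_eq_norm, ← sub_smul, norm_smul, mul_comm]
  have hft := (hl.lipschitzOnWith (s := uIcc 0 1)).absolutelyContinuousOnInterval.integral_deriv_eq_sub
  simp only [one_smul, zero_smul, add_zero] at hft
  rw [← hft, intervalIntegral.integral_of_le zero_le_one]
  refine (enorm_integral_le_lintegral_enorm _).trans ?_
  refine lintegral_mono_ae ?_
  filter_upwards [ae_restrict_of_ae hx] with t ht
  have hd : HasDerivAt (fun t : ℝ => v (x + t • z)) (fderiv ℝ v (x + t • z) z) t := by
    have h2 : HasDerivAt (fun t : ℝ => x + t • z) z t := by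
      simpa using ((hasDerivAt_id t).smul_const z).const_add x
    exact ht.hasFDerivAt.comp_hasDerivAt t h2
  rw [hd.deriv]
  exact ContinuousLinearMap.le_opENorm _ _

lemma aux_diff {E : Type*} [NormedAddCommGroup E] [NormedSpace ℝ E] [FiniteDimensional ℝ E]
    [MeasurableSpace E] [BorelSpace E] (μ : Measure E) [μ.IsAddHaarMeasure]
    (v : E → ℝ) (K : ℝ≥0) (hv : LipschitzWith K v) (z : E) (R : ℝ) (hz : ‖z‖ < R) :
    ∫⁻ x in ball (0:E) R, ‖v (x + z) - v x‖ₑ ∂μ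
      ≤ ‖z‖ₑ * ∫⁻ x in ball (0:E) (2*R), ‖fderiv ℝ v x‖ₑ ∂μ := by
  have hmf : Measurable fun x => ‖fderiv ℝ v x‖ₑ := (measurable_fderiv ℝ v).enorm
  calc ∫⁻ x in ball (0:E) R, ‖v (x + z) - v x‖ₑ ∂μ
      ≤ ∫⁻ x in ball (0:E) R, (∫⁻ t in Ioc (0:ℝ) 1, ‖fderiv ℝ v (x + t • z)‖ₑ * ‖z‖ₑ) ∂μ :=
        lintegral_mono_ae (ae_restrict_of_ae (aux_seg μ v K hv z))
    _ = ∫⁻ t in Ioc (0:ℝ) 1, (∫⁻ x in ball (0:E) R, ‖fderiv ℝ v (x + t • z)‖ₑ * ‖z‖ₑ ∂μ) := by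
        refine lintegral_lintegral_swap (Measurable.aemeasurable ?_)
        exact (hmf.comp (by fun_prop : Measurable fun p : E × ℝ => p.1 + p.2 • z)).mul_const _
    _ ≤ ∫⁻ t in Ioc (0:ℝ) 1, ‖z‖ₑ * ∫⁻ x in ball (0:E) (2*R), ‖fderiv ℝ v x‖ₑ ∂μ := by
        refine setLIntegral_mono measurable_const fun t ht => ?_
        have hm2 : Measurable fun x : E => ‖fderiv ℝ v (x + t • z)‖ₑ :=
          hmf.comp (by fun_prop : Measurable fun x : E => x + t • z)
        rw [lintegral_mul_const _ hm2, mul_comm]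
        gcongr ‖z‖ₑ * ?_
        rw [← lintegral_indicator measurableSet_ball, ← lintegral_indicator measurableSet_ball,
          ← lintegral_add_right_eq_self ((ball (0:E) (2*R)).indicator _) (t • z)]
        refine lintegral_mono fun x => ?_
        by_cases hx : x ∈ ball (0:E) R
        · have : x + t • z ∈ ball (0:E) (2*R) := by
            rw [mem_ball_zero_iff] at *
            have h1 : ‖t • z‖ ≤ ‖z‖ := by
              rw [norm_smul, Real.norm_of_nonneg ht.1.le]
              nlinarith [norm_nonneg z, ht.2]
            linarith [norm_add_le x (t • z)]
          rw [indicator_of_mem hx, indicator_of_mem this]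
        · simp [hx]
    _ = _ := by simp

lemma aux_radial (d : ℕ) (hd : 1 ≤ d) (A : Set ℝ) (hA : MeasurableSet A) (hA0 : A ⊆ Ioi 0) (p : ℝ)
    (hi : IntegrableOn (fun y : ℝ => y ^ ((d:ℝ) - 1 + p)) A) :
    ∫⁻ z : EuclideanSpace ℝ (Fin d), A.indicator (fun y => ENNReal.ofReal (y ^ p)) ‖z‖
      = ENNReal.ofReal (d * (volume : Measure (EuclideanSpace ℝ (Fin d))).real (ball 0 1) *
        ∫ y in A, y ^ ((d:ℝ) - 1 + p)) := by
  have : Nonempty (Fin d) := ⟨⟨0, hd⟩⟩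
  have : Nontrivial (EuclideanSpace ℝ (Fin d)) := inferInstance
  have key : EqOn (fun y : ℝ => y ^ (Module.finrank ℝ (EuclideanSpace ℝ (Fin d)) - 1) •
      A.indicator (fun y => y ^ p) y) (A.indicator fun y : ℝ => y ^ ((d:ℝ) - 1 + p)) (Ioi 0) := by
    intro y hy
    by_cases h : y ∈ A
    · simp only [indicator_of_mem h, finrank_euclideanSpace, Fintype.card_fin, smul_eq_mul]
      rw [Real.rpow_add hy, ← Real.rpow_natCast, Nat.cast_sub hd, Nat.cast_one]
    · simp [h]
  have hi2 : Integrable (fun z : EuclideanSpace ℝ (Fin d) => A.indicator (fun y => y ^ p) ‖z‖) := by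
    rw [integrable_fun_norm_addHaar volume (f := A.indicator (fun y => y ^ p)),
      integrableOn_congr_fun key measurableSet_Ioi]
    exact ((integrable_indicator_iff hA).2 hi).integrableOn
  have h0 : ∀ y : ℝ, 0 ≤ A.indicator (fun y => y ^ p) y := by
    intro y
    refine indicator_nonneg (fun y hy => Real.rpow_nonneg (hA0 hy).le _) y
  have e := ofReal_integral_eq_lintegral_ofReal hi2 (Filter.Eventually.of_forall fun z => h0 _)
  rw [integral_fun_norm_addHaar volume (A.indicator (fun y => y ^ p)),
    setIntegral_congr_fun measurableSet_Ioi key, setIntegral_indicator hA,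
    inter_eq_self_of_subset_right hA0] at e
  simp only [finrank_euclideanSpace, Fintype.card_fin, smul_eq_mul, nsmul_eq_mul, ← mul_assoc] at e
  rw [e]
  refine lintegral_congr fun z => ?_
  by_cases h : ‖z‖ ∈ A <;> simp [h]

lemma aux_rad1 (d : ℕ) (hd : 1 ≤ d) (s R : ℝ) (hs : 1/2 ≤ s) (hR : 0 < R) :
    ∫⁻ z : EuclideanSpace ℝ (Fin d),
        (Ici R).indicator (fun y => ENNReal.ofReal (y ^ (-((d:ℝ) + 2*s)))) ‖z‖
      = ENNReal.ofReal (d * (volume : Measure (EuclideanSpace ℝ (Fin d))).real (ball 0 1) *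
        (R ^ (-(2*s)) / (2*s))) := by
  have he : (d:ℝ) - 1 + (-((d:ℝ) + 2*s)) = -1 - 2*s := by ring
  rw [aux_radial d hd _ measurableSet_Ici (fun y hy => lt_of_lt_of_le hR hy) _ ?_, he,
    integral_Ici_eq_integral_Ioi, integral_Ioi_rpow_of_lt (by linarith) hR]
  · congr 2
    rw [show -1 - 2*s + 1 = -(2*s) by ring, neg_div_neg_eq]
  · rw [he, integrableOn_Ici_iff_integrableOn_Ioi]
    exact integrableOn_Ioi_rpow_of_lt (by linarith) hR

lemma aux_rad2 (d : ℕ) (hd : 1 ≤ d) (s a : ℝ) (hs : s < 1) (ha : 0 < a) :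
    ∫⁻ z : EuclideanSpace ℝ (Fin d),
        (Ioo 0 a).indicator (fun y => ENNReal.ofReal (y ^ (2-((d:ℝ) + 2*s)))) ‖z‖
      = ENNReal.ofReal (d * (volume : Measure (EuclideanSpace ℝ (Fin d))).real (ball 0 1) *
        (a ^ (2-2*s) / (2-2*s))) := by
  have he : (d:ℝ) - 1 + (2-((d:ℝ) + 2*s)) = 1 - 2*s := by ring
  rw [aux_radial d hd _ measurableSet_Ioo (fun y hy => hy.1) _ ?_, he,
    ← integral_Ioc_eq_integral_Ioo, ← intervalIntegral.integral_of_le ha.le,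
    integral_rpow (Or.inl (by linarith))]
  · congr 2
    rw [show 1 - 2*s + 1 = 2-(2*s) by ring, Real.zero_rpow (by linarith), sub_zero]
  · rw [he]
    have := (intervalIntegral.intervalIntegrable_rpow' (a := 0) (b := a) (r := 1 - 2*s) (by linarith))
    rw [intervalIntegrable_iff_integrableOn_Ioo_of_le ha.le] at this
    exact this

lemma aux_rad3 (d : ℕ) (hd : 1 ≤ d) (a R : ℝ) (ha : 0 < a) (hR : a ≤ R) :
    ∫⁻ z : EuclideanSpace ℝ (Fin d),
        (Ico a R).indicator (fun y => ENNReal.ofReal (y ^ (-(d:ℝ)))) ‖z‖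
      = ENNReal.ofReal (d * (volume : Measure (EuclideanSpace ℝ (Fin d))).real (ball 0 1) *
        Real.log (R / a)) := by
  have he : (d:ℝ) - 1 + (-(d:ℝ)) = -1 := by ring
  rw [aux_radial d hd _ measurableSet_Ico (fun y hy => lt_of_lt_of_le ha hy.1) _ ?_, he,
    integral_Ico_eq_integral_Ioo, ← integral_Ioc_eq_integral_Ioo,
    ← intervalIntegral.integral_of_le hR]
  · simp_rw [Real.rpow_neg_one]
    rw [integral_inv_of_pos ha (lt_of_lt_of_le ha hR)]
  · rw [he]
    refine IntegrableOn.mono_set (t := Icc a R) ?_ Ico_subset_Icc_self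
    refine ContinuousOn.integrableOn_Icc ?_
    exact continuousOn_id.rpow_const fun x hx => Or.inl (ne_of_gt (lt_of_lt_of_le ha hx.1))

lemma aux_tonelli {E : Type*} [NormedAddCommGroup E] [NormedSpace ℝ E] [FiniteDimensional ℝ E]
    [MeasurableSpace E] [BorelSpace E] (μ : Measure E) [μ.IsAddHaarMeasure]
    (F : E × E → ℝ≥0∞) (H : E → E → ℝ≥0∞) (B : Set E) (hB : MeasurableSet B)
    (hH : Measurable (Function.uncurry H))
    (h1 : ∀ x ∈ B, ∀ y, F (x, y) ≤ H x (y - x)) (h2 : ∀ x ∈ B, ∀ y, F (y, x) ≤ H x (y - x)) :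
    ∫⁻ p in (Bᶜ ×ˢ Bᶜ)ᶜ, F p ∂(μ.prod μ) ≤ 2 * ∫⁻ z, (∫⁻ x in B, H x z ∂μ) ∂μ := by
  have hS : MeasurableSet ((Bᶜ ×ˢ Bᶜ)ᶜ : Set (E × E)) := (hB.compl.prod hB.compl).compl
  set Q : E × E → ℝ≥0∞ := fun p => B.indicator (fun x => H x (p.2 - p.1)) p.1 with hQ
  have hQm : Measurable Q := by
    have : Q = (Prod.fst ⁻¹' B).indicator (fun p => Function.uncurry H (p.1, p.2 - p.1)) := by
      ext p
      by_cases h : p.1 ∈ B <;> simp [hQ, h, indicator]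
    rw [this]
    exact (hH.comp (by fun_prop)).indicator (measurable_fst hB)
  have hQi : ∫⁻ p, Q p ∂(μ.prod μ) = ∫⁻ z, (∫⁻ x in B, H x z ∂μ) ∂μ := by
    rw [lintegral_prod _ hQm.aemeasurable]
    have : ∀ x, ∫⁻ y, Q (x, y) ∂μ = B.indicator (fun x => ∫⁻ z, H x z ∂μ) x := by
      intro x
      by_cases h : x ∈ B
      · simp only [hQ, indicator_of_mem h]
        exact lintegral_sub_right_eq_self (fun y => H x y) x
      · simp [hQ, h]
    simp_rw [this]
    rw [lintegral_indicator hB]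
    exact lintegral_lintegral_swap hH.aemeasurable
  calc ∫⁻ p in (Bᶜ ×ˢ Bᶜ)ᶜ, F p ∂(μ.prod μ)
      ≤ ∫⁻ p in (Bᶜ ×ˢ Bᶜ)ᶜ, (Q p + Q p.swap) ∂(μ.prod μ) := by
        refine setLIntegral_mono' hS fun p hp => ?_
        obtain ⟨x, y⟩ := p
        by_cases hx : x ∈ B
        · refine le_add_right ?_
          simpa [hQ, hx] using h1 x hx y
        · have hy : y ∈ B := by
            by_contra hy
            exact hp ⟨hx, hy⟩
          refine le_add_left ?_
          simpa [hQ, hy] using h2 y hy x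
    _ ≤ ∫⁻ p, (Q p + Q p.swap) ∂(μ.prod μ) := setLIntegral_le_lintegral _ _
    _ = _ := by
        rw [lintegral_add_left hQm, lintegral_prod_swap, hQi, two_mul]

noncomputable def auxk1 (d : ℕ) (s R : ℝ) (r : ℝ) : ℝ≥0∞ :=
  4 * (Ici R).indicator (fun y => ENNReal.ofReal (y ^ (-((d:ℝ) + 2*s)))) r

noncomputable def auxk2 (d : ℕ) (s L : ℝ) (r : ℝ) : ℝ≥0∞ :=
  ENNReal.ofReal L * (Ioo 0 (1/L)).indicator (fun y => ENNReal.ofReal (y ^ (1-((d:ℝ) + 2*s)))) r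

noncomputable def auxk3 (d : ℕ) (s L R : ℝ) (r : ℝ) : ℝ≥0∞ :=
  ENNReal.ofReal (2 * L ^ (2*s-1)) *
    (Ico (1/L) R).indicator (fun y => ENNReal.ofReal (y ^ (-(d:ℝ)-1))) r

lemma auxk1_meas (d : ℕ) (s R : ℝ) : Measurable (auxk1 d s R) := by
  refine Measurable.const_mul (Measurable.indicator ?_ measurableSet_Ici) _
  fun_prop

lemma auxk2_meas (d : ℕ) (s R : ℝ) : Measurable (auxk2 d s R) := by
  refine Measurable.const_mul (Measurable.indicator ?_ measurableSet_Ioo) _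
  fun_prop

lemma auxk3_meas (d : ℕ) (s L R : ℝ) : Measurable (auxk3 d s L R) := by
  refine Measurable.const_mul (Measurable.indicator ?_ measurableSet_Ico) _
  fun_prop

lemma aux_ptwise (d : ℕ) (s L R r a b : ℝ) (hs : 1/2 ≤ s) (hL : 2 ≤ L) (hR : 1 ≤ R)
    (hr : 0 ≤ r) (ha : |a| ≤ 1) (hb : |b| ≤ 1) (h0 : r = 0 → a = b)
    (hl : r < R → |a - b| ≤ L * r) (w : ℝ) (hw : r < R → w = |a - b|) :
    ENNReal.ofReal ((a - b)^2 / r ^ ((d:ℝ) + 2*s)) ≤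
      auxk1 d s R r + (auxk2 d s L r + auxk3 d s L R r) * ENNReal.ofReal w := by
  have hL0 : 0 < L := by linarith
  have hD : |a - b| ≤ 2 := by linarith [abs_sub a b]
  rw [← sq_abs (a - b)]
  have hD0 := abs_nonneg (a - b)
  rcases hr.eq_or_lt with h | hr
  · simp [h0 h.symm]
  rw [div_eq_mul_inv, ← Real.rpow_neg hr.le]
  have hp := Real.rpow_nonneg hr.le (-((d:ℝ) + 2*s))
  by_cases h1 : R ≤ r
  · refine le_add_right ?_
    rw [auxk1, indicator_of_mem (mem_Ici.2 h1), ← ENNReal.ofReal_ofNat,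
      ← ENNReal.ofReal_mul (by norm_num)]
    refine ENNReal.ofReal_le_ofReal ?_
    gcongr
    nlinarith
  push Not at h1
  refine le_add_left ?_
  rw [hw h1]
  by_cases h2 : r < 1/L
  · refine le_trans ?_ (mul_le_mul_left (le_add_right le_rfl) _)
    rw [auxk2, indicator_of_mem (show r ∈ Ioo 0 (1/L) from ⟨hr, h2⟩),
      ← ENNReal.ofReal_mul (by positivity), ← ENNReal.ofReal_mul (by positivity)]
    refine ENNReal.ofReal_le_ofReal ?_
    rw [sub_eq_add_neg 1, Real.rpow_add hr, Real.rpow_one]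
    have := hl h1
    calc |a - b|^2 * r ^ (-((d:ℝ) + 2*s)) = |a - b| * (|a - b| * r ^ (-((d:ℝ) + 2*s))) := by ring
      _ ≤ (L * r) * (|a - b| * r ^ (-((d:ℝ) + 2*s))) := by gcongr
      _ = _ := by ring
  · push Not at h2
    refine le_trans ?_ (mul_le_mul_left (le_add_left le_rfl) _)
    rw [auxk3, indicator_of_mem (show r ∈ Ico (1/L) R from ⟨h2, h1⟩),
      ← ENNReal.ofReal_mul (by positivity), ← ENNReal.ofReal_mul (by positivity)]
    refine ENNReal.ofReal_le_ofReal ?_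
    have e : r ^ (-((d:ℝ) + 2*s)) = (r⁻¹) ^ (2*s-1) * r ^ (-(d:ℝ)-1) := by
      rw [Real.inv_rpow hr.le, ← Real.rpow_neg hr.le, ← Real.rpow_add hr]
      congr 1; ring
    have h3 : (r⁻¹) ^ (2*s-1) ≤ L ^ (2*s-1) := by
      refine Real.rpow_le_rpow (by positivity) ?_ (by linarith)
      rw [inv_le_comm₀ hr hL0]; simpa using h2
    rw [e]
    calc |a - b|^2 * ((r⁻¹) ^ (2*s-1) * r ^ (-(d:ℝ)-1))
        = |a - b| * (|a - b| * ((r⁻¹) ^ (2*s-1) * r ^ (-(d:ℝ)-1))) := by ring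
      _ ≤ 2 * (|a - b| * (L ^ (2*s-1) * r ^ (-(d:ℝ)-1))) := by gcongr
      _ = _ := by ring

lemma aux_k1_int (d : ℕ) (hd : 1 ≤ d) (s R : ℝ) (hs : 1/2 ≤ s) (hR : 0 < R) :
    ∫⁻ z : EuclideanSpace ℝ (Fin d), auxk1 d s R ‖z‖ =
      ENNReal.ofReal (4 * (d * (volume : Measure (EuclideanSpace ℝ (Fin d))).real (ball 0 1) *
        (R ^ (-(2*s)) / (2*s)))) := by
  simp only [auxk1]
  rw [lintegral_const_mul' _ _ (by simp), aux_rad1 d hd s R hs hR, ENNReal.ofReal_mul (p := 4) (by norm_num),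
    ENNReal.ofReal_ofNat]

lemma aux_k2_int (d : ℕ) (hd : 1 ≤ d) (s L : ℝ) (hs : s < 1) (hL : 0 < L) :
    ∫⁻ z : EuclideanSpace ℝ (Fin d), auxk2 d s L ‖z‖ * ‖z‖ₑ =
      ENNReal.ofReal (L ^ (2*s-1) *
        (d * (volume : Measure (EuclideanSpace ℝ (Fin d))).real (ball 0 1) / (2-2*s))) := by
  have : ∀ z : EuclideanSpace ℝ (Fin d), auxk2 d s L ‖z‖ * ‖z‖ₑ = ENNReal.ofReal L *
      (Ioo 0 (1/L)).indicator (fun y => ENNReal.ofReal (y ^ (2-((d:ℝ) + 2*s)))) ‖z‖ := by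
    intro z
    rw [auxk2, mul_assoc]
    congr 1
    by_cases h : ‖z‖ ∈ Ioo 0 (1/L)
    · rw [indicator_of_mem h, indicator_of_mem h, ← ofReal_norm,
        ← ENNReal.ofReal_mul (by positivity)]
      congr 1
      rw [show 2 - ((d:ℝ) + 2*s) = 1 - ((d:ℝ) + 2*s) + 1 by ring, Real.rpow_add h.1, Real.rpow_one]
    · simp only [indicator_of_notMem h, zero_mul]
  simp_rw [this]
  rw [lintegral_const_mul' _ _ (by simp), aux_rad2 d hd s _ hs (by positivity),
    ← ENNReal.ofReal_mul hL.le]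
  congr 1
  rw [one_div, Real.inv_rpow hL.le, ← Real.rpow_neg hL.le,
    show 2*s-1 = 1 + (-(2 - 2*s)) by ring, Real.rpow_add hL, Real.rpow_one]
  ring

lemma aux_k3_int (d : ℕ) (hd : 1 ≤ d) (s L R : ℝ) (hL : 2 ≤ L) (hR : 1 ≤ R) :
    ∫⁻ z : EuclideanSpace ℝ (Fin d), auxk3 d s L R ‖z‖ * ‖z‖ₑ =
      ENNReal.ofReal (2 * L ^ (2*s-1) *
        (d * (volume : Measure (EuclideanSpace ℝ (Fin d))).real (ball 0 1) * Real.log (L*R))) := by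
  have hL0 : 0 < L := by linarith
  have ha : 0 < 1/L := by positivity
  have : ∀ z : EuclideanSpace ℝ (Fin d), auxk3 d s L R ‖z‖ * ‖z‖ₑ =
      ENNReal.ofReal (2 * L ^ (2*s-1)) *
      (Ico (1/L) R).indicator (fun y => ENNReal.ofReal (y ^ (-(d:ℝ)))) ‖z‖ := by
    intro z
    rw [auxk3, mul_assoc]
    congr 1
    by_cases h : ‖z‖ ∈ Ico (1/L) R
    · rw [indicator_of_mem h, indicator_of_mem h, ← ofReal_norm,
        ← ENNReal.ofReal_mul (by positivity)]
      congr 1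
      have hz : 0 < ‖z‖ := lt_of_lt_of_le ha h.1
      have := Real.rpow_add hz (-(d:ℝ) - 1) 1
      rw [Real.rpow_one, sub_add_cancel] at this
      exact this.symm
    · simp only [indicator_of_notMem h, zero_mul]
  simp_rw [this]
  rw [lintegral_const_mul' _ _ ENNReal.ofReal_ne_top, aux_rad3 d hd _ R ha, ← ENNReal.ofReal_mul (by positivity)]
  · congr 4
    field_simp
  · refine le_trans ?_ hR
    rw [div_le_one hL0]; linarith

lemma aux_sum (d : ℕ) (hd : 1 ≤ d) (s L R : ℝ) (hs : 1/2 ≤ s) (hs1 : s < 1) (hL : 2 ≤ L)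
    (hR : 1 ≤ R) (v : EuclideanSpace ℝ (Fin d) → ℝ) (K : ℝ≥0) (hv : LipschitzWith K v) :
    ∫⁻ z, (∫⁻ x in ball (0 : EuclideanSpace ℝ (Fin d)) R, (auxk1 d s R ‖z‖ +
      (auxk2 d s L ‖z‖ + auxk3 d s L R ‖z‖) * ENNReal.ofReal |v (x + z) - v x|)) ≤
    (∫⁻ z : EuclideanSpace ℝ (Fin d), auxk1 d s R ‖z‖) *
        volume (ball (0 : EuclideanSpace ℝ (Fin d)) R) +
      ((∫⁻ z : EuclideanSpace ℝ (Fin d), auxk2 d s L ‖z‖ * ‖z‖ₑ) +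
      (∫⁻ z : EuclideanSpace ℝ (Fin d), auxk3 d s L R ‖z‖ * ‖z‖ₑ)) *
        ∫⁻ x in ball (0 : EuclideanSpace ℝ (Fin d)) (2*R), ‖fderiv ℝ v x‖ₑ := by
  have m1 := auxk1_meas d s R
  have m2 := auxk2_meas d s L
  have m3 := auxk3_meas d s L R
  have mv := hv.continuous.measurable
  have M1 : Measurable fun z : EuclideanSpace ℝ (Fin d) => auxk1 d s R ‖z‖ := by fun_prop
  have M2 : Measurable fun z : EuclideanSpace ℝ (Fin d) => auxk2 d s L ‖z‖ * ‖z‖ₑ := by fun_prop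
  have M3 : Measurable fun z : EuclideanSpace ℝ (Fin d) => auxk3 d s L R ‖z‖ * ‖z‖ₑ := by fun_prop
  have M23 : Measurable fun z : EuclideanSpace ℝ (Fin d) =>
    auxk2 d s L ‖z‖ * ‖z‖ₑ + auxk3 d s L R ‖z‖ * ‖z‖ₑ := M2.add M3
  rw [← lintegral_mul_const _ M1, ← lintegral_add_left M2, ← lintegral_mul_const _ M23,
    ← lintegral_add_left (M1.mul_const _)]
  refine lintegral_mono fun z => ?_
  rw [lintegral_add_left measurable_const, setLIntegral_const,
    lintegral_const_mul _ (by fun_prop)]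
  refine add_le_add_right ?_ _
  by_cases hz : ‖z‖ < R
  · have := aux_diff volume v K hv z R hz
    simp only [← ofReal_norm (v _ - v _), Real.norm_eq_abs] at this
    refine (mul_le_mul_right this _).trans (le_of_eq ?_)
    ring
  · have e2 : auxk2 d s L ‖z‖ = 0 := by
      rw [auxk2, indicator_of_notMem, mul_zero]
      rintro ⟨_, h⟩
      have : 1 / L ≤ 1 := by rw [div_le_one (by linarith)]; linarith
      linarith
    have e3 : auxk3 d s L R ‖z‖ = 0 := by
      rw [auxk3, indicator_of_notMem, mul_zero]
      rintro ⟨_, h⟩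
      linarith
    simp [e2, e3]

/-- Let `d ≥ 1`, `1/2 ≤ s < 1` and `L₀ ≥ 2`. There is `C = C(d,s)` such that
for every `R ≥ 1` and every `u : ℝ^d → ℝ` with `|u| ≤ 1` on `ℝ^d`, Lipschitz on `B_{2R}` with
`‖∇u‖_{L^∞(B_{2R})} ≤ L₀`, one has
`J^s(u,B_R) ≤ C · ( R^{d−2s} + L₀^{2s−1}·log(2L₀R)·∫_{B_{2R}} |∇u| )`. -/
theorem stmt3 (d : ℕ) (hd : 1 ≤ d) (s : ℝ) (hs0 : 1/2 ≤ s) (hs1 : s < 1) :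
    ∃ C : ℝ, 0 < C ∧ ∀ L₀ : ℝ, 2 ≤ L₀ → ∀ R : ℝ, 1 ≤ R →
      ∀ u : EuclideanSpace ℝ (Fin d) → ℝ, (∀ x, |u x| ≤ 1) →
        LipschitzOnWith (Real.toNNReal L₀) u (ball (0 : EuclideanSpace ℝ (Fin d)) (2*R)) →
        (∀ᵐ x ∂(volume.restrict (ball (0 : EuclideanSpace ℝ (Fin d)) (2*R))),
          ‖fderiv ℝ u x‖ ≤ L₀) →
        Js d s u (ball (0 : EuclideanSpace ℝ (Fin d)) R) ≤
          ENNReal.ofReal (C * (R ^ ((d : ℝ) - 2*s) + L₀ ^ (2*s - 1) * Real.log (2*L₀*R) *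
            ∫ x in ball (0 : EuclideanSpace ℝ (Fin d)) (2*R), ‖fderiv ℝ u x‖)) := by
  obtain ⟨vb, hvb⟩ : ∃ vb, vb = (volume : Measure (EuclideanSpace ℝ (Fin d))).real (ball 0 1) :=
    ⟨_, rfl⟩
  have hvb0 : 0 ≤ vb := hvb ▸ measureReal_nonneg
  have hs2 : 0 < 2 - 2*s := by linarith
  have hs3 : 0 < 2*s := by linarith
  refine ⟨2*(4*(d*vb)*vb/(2*s) + (d*vb)/(2-2*s) + 2*(d*vb)) + 1, by positivity, ?_⟩
  intro L hL R hR u hu hlip _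
  have hL0 : 0 < L := by linarith
  have hR0 : 0 < R := by linarith
  obtain ⟨v, hv, huv⟩ := hlip.extend_real
  have hG : ∫⁻ x in ball (0 : EuclideanSpace ℝ (Fin d)) (2*R), ‖fderiv ℝ v x‖ₑ =
      ENNReal.ofReal (∫ x in ball (0 : EuclideanSpace ℝ (Fin d)) (2*R), ‖fderiv ℝ u x‖) := by
    have hi : IntegrableOn (fderiv ℝ v) (ball (0 : EuclideanSpace ℝ (Fin d)) (2*R)) := by
      refine Measure.integrableOn_of_bounded (M := L.toNNReal) measure_ball_lt_top.ne
        (measurable_fderiv ℝ v).aestronglyMeasurable ?_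
      exact Filter.Eventually.of_forall fun x => norm_fderiv_le_of_lipschitz ℝ hv
    rw [← ofReal_integral_norm_eq_lintegral_enorm hi]
    congr 1
    refine setIntegral_congr_fun measurableSet_ball fun x hx => ?_
    have : u =ᶠ[nhds x] v := Filter.eventuallyEq_of_mem (isOpen_ball.mem_nhds hx) huv
    simp only [this.fderiv_eq]
  set I := ∫ x in ball (0 : EuclideanSpace ℝ (Fin d)) (2*R), ‖fderiv ℝ u x‖ with hI
  have hI0 : 0 ≤ I := integral_nonneg fun x => norm_nonneg _
  have hpt : ∀ x ∈ ball (0 : EuclideanSpace ℝ (Fin d)) R, ∀ y,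
      ENNReal.ofReal ((u x - u y)^2 / ‖x - y‖ ^ ((d : ℝ) + 2*s)) ≤ auxk1 d s R ‖y - x‖ +
      (auxk2 d s L ‖y - x‖ + auxk3 d s L R ‖y - x‖) *
        ENNReal.ofReal |v (x + (y - x)) - v x| := by
    intro x hx y
    rw [norm_sub_rev x y]
    have hx2 : x ∈ ball (0 : EuclideanSpace ℝ (Fin d)) (2*R) :=
      ball_subset_ball (by linarith) hx
    have hy2 : ‖y - x‖ < R → y ∈ ball (0 : EuclideanSpace ℝ (Fin d)) (2*R) := by
      intro h
      rw [mem_ball_zero_iff] at *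
      have := norm_add_le (y - x) x
      rw [sub_add_cancel] at this
      linarith
    have key : ‖y - x‖ < R → |v (x + (y - x)) - v x| = |u x - u y| := by
      intro h
      rw [add_sub_cancel, ← huv hx2, ← huv (hy2 h), abs_sub_comm]
    refine aux_ptwise d s L R _ _ _ hs0 hL hR (norm_nonneg _) (hu x) (hu y) ?_ ?_ _ key
    · intro h
      rw [norm_eq_zero, sub_eq_zero] at h
      rw [h]
    · intro h
      have := hlip.dist_le_mul _ hx2 _ (hy2 h)
      rwa [Real.dist_eq, dist_eq_norm, norm_sub_rev, Real.coe_toNNReal _ hL0.le] at this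
  have hm : Measurable (Function.uncurry fun x z : EuclideanSpace ℝ (Fin d) =>
      auxk1 d s R ‖z‖ + (auxk2 d s L ‖z‖ + auxk3 d s L R ‖z‖) *
        ENNReal.ofReal |v (x + z) - v x|) := by
    have m1 := auxk1_meas d s R
    have m2 := auxk2_meas d s L
    have m3 := auxk3_meas d s L R
    have mv := hv.continuous.measurable
    unfold Function.uncurry
    have m4 : Measurable fun p : EuclideanSpace ℝ (Fin d) × EuclideanSpace ℝ (Fin d) =>
      |v (p.1 + p.2) - v p.1| := by
      have := hv.continuous
      exact Continuous.measurable (by fun_prop)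
    fun_prop
  have h1 := aux_tonelli volume
    (fun p => ENNReal.ofReal ((u p.1 - u p.2)^2 / ‖p.1 - p.2‖ ^ ((d : ℝ) + 2*s))) _
    (ball (0 : EuclideanSpace ℝ (Fin d)) R) measurableSet_ball hm hpt (by
      intro x hx y
      have := hpt x hx y
      rwa [norm_sub_rev x y, show (u x - u y)^2 = (u y - u x)^2 by ring] at this)
  have h2 := aux_sum d hd s L R hs0 hs1 hL hR v _ hv
  rw [aux_k1_int d hd s R hs0 hR0, aux_k2_int d hd s L hs1 hL0, aux_k3_int d hd s L R hL hR, hG,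
    Measure.addHaar_ball_of_pos _ _ hR0, ← ofReal_measureReal measure_ball_lt_top.ne, ← hvb,
    finrank_euclideanSpace, Fintype.card_fin] at h2
  have hlog0 : 0 ≤ Real.log (L*R) := Real.log_nonneg (by nlinarith)
  have hlog1 : Real.log (L*R) ≤ Real.log (2*L*R) :=
    Real.log_le_log (by positivity) (by nlinarith [mul_pos hL0 hR0])
  have hlog2 : 1 ≤ Real.log (2*L*R) := by
    rw [Real.le_log_iff_exp_le (by positivity)]
    nlinarith [Real.exp_one_lt_d9]
  rw [← ENNReal.ofReal_mul (by positivity), ← ENNReal.ofReal_mul (by positivity),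
    ← ENNReal.ofReal_add (by positivity) (by positivity), ← ENNReal.ofReal_mul (by positivity),
    ← ENNReal.ofReal_add (by positivity) (by positivity)] at h2
  refine (h1.trans (mul_le_mul_right h2 2)).trans ?_
  rw [← ENNReal.ofReal_ofNat, ← ENNReal.ofReal_mul (by norm_num)]
  refine ENNReal.ofReal_le_ofReal ?_
  have hRR : R ^ ((d:ℝ) - 2*s) = R ^ (-(2*s)) * R ^ d := by
    rw [sub_eq_add_neg, add_comm, Real.rpow_add hR0, Real.rpow_natCast]
  rw [hRR]
  set P := R ^ (-(2*s)) * R ^ d with hP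
  have hP0 : 0 ≤ P := by positivity
  set M := L ^ (2*s-1) with hM
  have hM0 : 0 ≤ M := by positivity
  set ℓ := Real.log (2*L*R)
  set c := (d:ℝ)*vb with hc
  have hc0 : 0 ≤ c := by positivity
  have t1 : 0 ≤ c/(2-2*s) := by positivity
  have t2 : 0 ≤ 4*c*vb/(2*s) := by positivity
  have q1 : M * (c/(2-2*s)) * I ≤ (c/(2-2*s)) * (M * ℓ * I) := by
    have : 0 ≤ c/(2-2*s) * (M * I) * (ℓ - 1) := by
      have : 0 ≤ ℓ - 1 := by linarith
      positivity
    nlinarith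
  have q2 : 2 * M * (c * Real.log (L*R)) * I ≤ 2 * c * (M * ℓ * I) := by
    have : 0 ≤ c * (M * I) * (ℓ - Real.log (L*R)) := by
      have : 0 ≤ ℓ - Real.log (L*R) := by linarith
      positivity
    nlinarith
  have hX : 0 ≤ M * ℓ * I := by
    have : 0 ≤ ℓ := by linarith
    positivity
  have e1 : 4 * (c * (R ^ (-(2*s)) / (2*s))) * (R ^ d * vb) = 4*c*vb/(2*s) * P := by
    rw [hP]; ring
  rw [add_mul, e1]
  set X := M * ℓ * I
  nlinarith [mul_nonneg t1 hP0, mul_nonneg t2 hX, mul_nonneg hc0 hP0]
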